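/- There exists a constant C > 0 such that for all t ∈ (0,1]: |∂²_x ∂_y K_t(x,y)|_{x=0, y=1}| ≤ C · t^{-7/2} e^{-1/(4t)} and |∂²_x ∂_y K_t(x,y)|_{x=0, y=-1}| ≤ C · t^{-7/2} e^{-1/(4t)}, where ∂_x denotes differentiation in the first variable and ∂_y in the second. -/

import Mathlib

open Real Set

/-- The Dirichlet heat kernel of the interval `[-1,1]`:
`K t x y = (4πt)^{-1/2} (∑_{k ∈ ℤ} e^{-(x-y+4k)²/(4t)} − ∑_{k ∈ ℤ} e^{-(x+y+4k-2)²/(4t)})`. -/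
noncomputable def K (t x y : ℝ) : ℝ :=
  (Real.sqrt (4 * Real.pi * t))⁻¹ *
    ((∑' k : ℤ, Real.exp (-(x - y + 4 * (k : ℝ)) ^ 2 / (4 * t))) -
     (∑' k : ℤ, Real.exp (-(x + y + 4 * (k : ℝ) - 2) ^ 2 / (4 * t))))

noncomputable def gK (t : ℝ) (j : ℕ) (u : ℝ) : ℝ := u ^ j * Real.exp (-u ^ 2 / (4 * t))

noncomputable def GK (t : ℝ) (j : ℕ) (z : ℝ) : ℝ := ∑' k : ℤ, gK t j (z + 4 * (k : ℝ))

lemma gK_bound (t : ℝ) (ht : 0 < t) (j : ℕ) (u : ℝ) :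
    |gK t j u| ≤ (j.factorial * Real.exp (4 * t)) * Real.exp (-|u|) := by
  unfold gK
  rw [abs_mul, abs_pow, abs_of_pos (Real.exp_pos _)]
  have h1 : |u| ^ j ≤ j.factorial * Real.exp |u| := by
    have := Real.pow_div_factorial_le_exp |u| (abs_nonneg u) j
    rw [div_le_iff₀ (by positivity)] at this
    linarith
  have h2 : Real.exp (-u ^ 2 / (4 * t)) ≤ Real.exp (4 * t - 2 * |u|) := by
    apply Real.exp_le_exp.mpr
    rw [div_le_iff₀ (by positivity)]
    have := sq_nonneg (|u| - 4 * t)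
    have h3 := sq_abs u
    nlinarith
  calc |u| ^ j * Real.exp (-u ^ 2 / (4 * t))
      ≤ (j.factorial * Real.exp |u|) * Real.exp (4 * t - 2 * |u|) := by gcongr
    _ = (j.factorial * Real.exp (4 * t)) * Real.exp (-|u|) := by
      rw [mul_assoc, mul_assoc, ← Real.exp_add, ← Real.exp_add]; congr 2; ring

lemma summable_expabs : Summable (fun k : ℤ => Real.exp (-(4 * |(k : ℝ)|))) := by
  have h : Summable (fun n : ℕ => Real.exp (-(4 * (n : ℝ)))) := by
    have := Real.summable_exp_nat_mul_iff (a := -4) |>.mpr (by norm_num)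
    refine this.congr fun n => ?_
    congr 1; ring
  apply Summable.of_nat_of_neg
  · simpa using h
  · simpa using h

lemma gK_bound' (t : ℝ) (ht : 0 < t) (j : ℕ) (R z : ℝ) (hz : |z| ≤ R) (k : ℤ) :
    |gK t j (z + 4 * (k : ℝ))| ≤
      (j.factorial * Real.exp (4 * t) * Real.exp R) * Real.exp (-(4 * |(k : ℝ)|)) := by
  refine (gK_bound t ht j _).trans ?_
  rw [mul_assoc _ (Real.exp R), ← Real.exp_add]
  gcongr
  have h : |4 * (k : ℝ)| = 4 * |(k : ℝ)| := by rw [abs_mul]; norm_num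
  have := abs_sub_abs_le_abs_sub (4 * (k : ℝ)) (-z)
  rw [abs_neg, h, sub_neg_eq_add, add_comm (4 * (k : ℝ))] at this
  linarith

lemma gK_summable (t : ℝ) (ht : 0 < t) (j : ℕ) (z : ℝ) :
    Summable (fun k : ℤ => gK t j (z + 4 * (k : ℝ))) := by
  refine Summable.of_norm_bounded (summable_expabs.mul_left
    (j.factorial * Real.exp (4 * t) * Real.exp |z|)) fun k => ?_
  exact gK_bound' t ht j |z| z le_rfl k

lemma gK_deriv (t : ℝ) (ht : 0 < t) (j : ℕ) (u : ℝ) :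
    HasDerivAt (gK t j) (j * gK t (j - 1) u - 1 / (2 * t) * gK t (j + 1) u) u := by
  unfold gK
  have h1 : HasDerivAt (fun u : ℝ => -u ^ 2 / (4 * t)) (-(2 * u) / (4 * t)) u := by
    have := ((hasDerivAt_pow 2 u).neg).div_const (4 * t)
    simpa using this
  have := (hasDerivAt_pow j u).mul h1.exp
  refine this.congr_deriv ?_
  field_simp
  ring

lemma GK_deriv (t : ℝ) (ht : 0 < t) (j : ℕ) (z : ℝ) :
    HasDerivAt (GK t j) (j * GK t (j - 1) z - 1 / (2 * t) * GK t (j + 1) z) z := by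
  have key := hasDerivAt_tsum_of_isPreconnected (𝕜 := ℝ) (F := ℝ)
    (g := fun (k : ℤ) z => gK t j (z + 4 * (k : ℝ)))
    (g' := fun (k : ℤ) z => j * gK t (j - 1) (z + 4 * (k : ℝ))
      - 1 / (2 * t) * gK t (j + 1) (z + 4 * (k : ℝ)))
    (u := fun k : ℤ => (j * ((j - 1).factorial * Real.exp (4 * t) * Real.exp (|z| + 1))) *
        Real.exp (-(4 * |(k : ℝ)|)) + (1 / (2 * t) * ((j + 1).factorial * Real.exp (4 * t) *
          Real.exp (|z| + 1))) * Real.exp (-(4 * |(k : ℝ)|)))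
    (t := Metric.ball 0 (|z| + 1)) (y₀ := z) (y := z)
    ((summable_expabs.mul_left _).add (summable_expabs.mul_left _))
    Metric.isOpen_ball (convex_ball _ _).isPreconnected
    (fun k y _ => by
      simpa using (gK_deriv t ht j (y + 4 * (k : ℝ))).comp_add_const y (4 * (k : ℝ)))
    (fun k y hy => by
      have hy' : |y| ≤ |z| + 1 := by
        have : |y| < |z| + 1 := by simpa using hy
        exact this.le
      refine (norm_sub_le _ _).trans ?_
      rw [norm_mul, norm_mul, Real.norm_natCast, Real.norm_of_nonneg (by positivity : 0 ≤ 1 / (2 * t)),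
        mul_assoc (j : ℝ), mul_assoc (1 / (2 * t))]
      gcongr
      · exact gK_bound' t ht _ _ _ hy' k
      · exact gK_bound' t ht _ _ _ hy' k)
    (by simp) (gK_summable t ht j z) (by simp)
  refine key.congr_deriv ?_
  rw [Summable.tsum_sub ((gK_summable t ht _ z).mul_left _) ((gK_summable t ht _ z).mul_left _),
    tsum_mul_left, tsum_mul_left]
  rfl

lemma K_eq (t x y : ℝ) : K t x y =
    (Real.sqrt (4 * Real.pi * t))⁻¹ * (GK t 0 (x - y) - GK t 0 (x + y - 2)) := by
  have h1 : GK t 0 (x - y) = ∑' k : ℤ, Real.exp (-(x - y + 4 * (k : ℝ)) ^ 2 / (4 * t)) := by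
    simp [GK, gK]
  have h2 : GK t 0 (x + y - 2) =
      ∑' k : ℤ, Real.exp (-(x + y + 4 * (k : ℝ) - 2) ^ 2 / (4 * t)) := by
    unfold GK gK
    congr 1
    funext k
    rw [show x + y + 4 * (k : ℝ) - 2 = x + y - 2 + 4 * (k : ℝ) by ring]
    simp
  rw [h1, h2, K]

noncomputable def S2 (t z : ℝ) : ℝ := -(1 / (2 * t)) * (GK t 0 z - 1 / (2 * t) * GK t 2 z)
noncomputable def S3 (t z : ℝ) : ℝ := 3 / (4 * t ^ 2) * GK t 1 z - 1 / (8 * t ^ 3) * GK t 3 z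

lemma S0_deriv (t : ℝ) (ht : 0 < t) (z : ℝ) :
    HasDerivAt (GK t 0) (-(1 / (2 * t)) * GK t 1 z) z := by
  refine (GK_deriv t ht 0 z).congr_deriv ?_
  simp

lemma S1_deriv (t : ℝ) (ht : 0 < t) (z : ℝ) :
    HasDerivAt (fun z => -(1 / (2 * t)) * GK t 1 z) (S2 t z) z := by
  refine ((GK_deriv t ht 1 z).const_mul _).congr_deriv ?_
  simp [S2]

lemma S2_deriv (t : ℝ) (ht : 0 < t) (z : ℝ) :
    HasDerivAt (S2 t) (S3 t z) z := by
  refine (((GK_deriv t ht 0 z).sub ((GK_deriv t ht 2 z).const_mul (1 / (2 * t)))).const_mul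
    (-(1 / (2 * t)))).congr_deriv ?_
  simp [S3]
  field_simp
  ring

lemma K_xx (t : ℝ) (ht : 0 < t) (y : ℝ) : deriv (deriv (fun x => K t x y)) 0 =
    (Real.sqrt (4 * Real.pi * t))⁻¹ * (S2 t (-y) - S2 t (y - 2)) := by
  have h1 : deriv (fun x => K t x y) = fun x => (Real.sqrt (4 * Real.pi * t))⁻¹ *
      (-(1 / (2 * t)) * GK t 1 (x - y) - -(1 / (2 * t)) * GK t 1 (x + (y - 2))) := by
    funext x
    have : (fun x => K t x y) = fun x => (Real.sqrt (4 * Real.pi * t))⁻¹ *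
        (GK t 0 (x - y) - GK t 0 (x + (y - 2))) := by
      funext x; rw [K_eq, add_sub_assoc]
    rw [this]
    exact ((((S0_deriv t ht (x - y)).comp_sub_const x y).sub
      ((S0_deriv t ht (x + (y - 2))).comp_add_const x (y - 2))).const_mul _).deriv
  rw [h1]
  have := ((((S1_deriv t ht (0 - y)).comp_sub_const 0 y).sub
      ((S1_deriv t ht (0 + (y - 2))).comp_add_const 0 (y - 2))).const_mul
      (Real.sqrt (4 * Real.pi * t))⁻¹).deriv
  rw [zero_sub, zero_add] at this
  exact this

lemma K_xxy (t : ℝ) (ht : 0 < t) (y : ℝ) :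
    deriv (fun y => deriv (deriv (fun x => K t x y)) 0) y =
    (Real.sqrt (4 * Real.pi * t))⁻¹ * (-S3 t (-y) - S3 t (y - 2)) := by
  simp_rw [K_xx t ht]
  have h1 : HasDerivAt (fun y => S2 t (-y)) (-S3 t (-y)) y := by
    have := (S2_deriv t ht (-y)).comp y (hasDerivAt_neg y)
    simpa [Function.comp_def] using this
  exact ((h1.sub ((S2_deriv t ht (y - 2)).comp_sub_const y 2)).const_mul _).deriv

/-- majorant constant -/
noncomputable def MK (z : ℝ) : ℝ := ∑' k : ℤ, |gK 1 3 (z + 4 * (k : ℝ))| * Real.exp (1 / 4)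

lemma MK_nonneg (z : ℝ) : 0 ≤ MK z := tsum_nonneg fun k => by positivity

lemma MK_summable (z : ℝ) :
    Summable fun k : ℤ => |gK 1 3 (z + 4 * (k : ℝ))| * Real.exp (1 / 4) :=
  ((gK_summable 1 one_pos 3 z).abs).mul_right _

lemma gK_big (t : ℝ) (ht : 0 < t) (ht1 : t ≤ 1) (j : ℕ) (hj : j ≤ 3) (u : ℝ) (hu : 1 ≤ |u|) :
    |gK t j u| ≤ Real.exp (-(1 / (4 * t))) * (|gK 1 3 u| * Real.exp (1 / 4)) := by
  unfold gK
  rw [abs_mul, abs_mul, abs_pow, abs_pow, abs_of_pos (Real.exp_pos _), abs_of_pos (Real.exp_pos _)]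
  have h1 : |u| ^ j ≤ |u| ^ 3 := pow_le_pow_right₀ hu hj
  have h2 : Real.exp (-u ^ 2 / (4 * t)) ≤
      Real.exp (-(1 / (4 * t))) * (Real.exp (-u ^ 2 / (4 * 1)) * Real.exp (1 / 4)) := by
    rw [← Real.exp_add, ← Real.exp_add]
    apply Real.exp_le_exp.mpr
    have hu2 : 1 ≤ u ^ 2 := by rw [← sq_abs]; nlinarith
    have h3 : 1 ≤ 1 / t := by rw [le_div_iff₀ ht]; linarith
    have e1 : -u ^ 2 / (4 * t) = -u ^ 2 / 4 * (1 / t) := by field_simp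
    have e2 : 1 / (4 * t) = 1 / 4 * (1 / t) := by field_simp
    rw [e1, e2]
    nlinarith
  calc _ ≤ |u| ^ 3 * _ := mul_le_mul h1 h2 (Real.exp_pos _).le (by positivity)
    _ = _ := by ring

lemma GK_big (t : ℝ) (ht : 0 < t) (ht1 : t ≤ 1) (j : ℕ) (hj : j ≤ 3) (z : ℝ)
    (hz : ∀ k : ℤ, 1 ≤ |z + 4 * (k : ℝ)|) :
    |GK t j z| ≤ Real.exp (-(1 / (4 * t))) * MK z := by
  unfold GK MK
  rw [← tsum_mul_left, ← Real.norm_eq_abs]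
  exact tsum_of_norm_bounded ((MK_summable z).mul_left _).hasSum
    fun k => gK_big t ht ht1 j hj _ (hz k)

lemma S3_big (t : ℝ) (ht : 0 < t) (ht1 : t ≤ 1) (z : ℝ)
    (hz : ∀ k : ℤ, 1 ≤ |z + 4 * (k : ℝ)|) :
    |S3 t z| ≤ (t ^ 3)⁻¹ * (Real.exp (-(1 / (4 * t))) * MK z) := by
  unfold S3
  have h1 := GK_big t ht ht1 1 (by norm_num) z hz
  have h3 := GK_big t ht ht1 3 (by norm_num) z hz
  set B := Real.exp (-(1 / (4 * t))) * MK z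
  have hB : 0 ≤ B := (abs_nonneg _).trans h1
  have hc : 3 / (4 * t ^ 2) ≤ 3 / 4 * (t ^ 3)⁻¹ := by
    rw [div_le_iff₀ (by positivity)]
    field_simp
    linarith
  calc _ ≤ |3 / (4 * t ^ 2) * GK t 1 z| + |1 / (8 * t ^ 3) * GK t 3 z| := abs_sub _ _
    _ = 3 / (4 * t ^ 2) * |GK t 1 z| + 1 / (8 * t ^ 3) * |GK t 3 z| := by
      rw [abs_mul, abs_mul, abs_of_pos (by positivity : 0 < 3 / (4 * t ^ 2)),
        abs_of_pos (by positivity : 0 < 1 / (8 * t ^ 3))]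
    _ ≤ (3 / 4 * (t ^ 3)⁻¹) * B + 1 / (8 * t ^ 3) * B := by gcongr
    _ = 7 / 8 * ((t ^ 3)⁻¹ * B) := by field_simp; ring
    _ ≤ _ := by
      have : 0 ≤ (t ^ 3)⁻¹ * B := by positivity
      linarith

lemma one_le_abs_of_int (m : ℤ) (hm : m ≠ 0) (x : ℝ) (hx : x = (m : ℝ)) : 1 ≤ |x| := by
  rw [hx]; exact_mod_cast Int.one_le_abs hm

lemma final_bound (t : ℝ) (ht : 0 < t) (ht1 : t ≤ 1) (y : ℝ)
    (h1 : ∀ k : ℤ, 1 ≤ |-y + 4 * (k : ℝ)|) (h2 : ∀ k : ℤ, 1 ≤ |y - 2 + 4 * (k : ℝ)|) :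
    |deriv (fun y => deriv (deriv (fun x => K t x y)) 0) y| ≤
      (MK (-y) + MK (y - 2)) * t ^ (-(7 : ℝ) / 2) * Real.exp (-(1 / (4 * t))) := by
  rw [K_xxy t ht, abs_mul, abs_of_nonneg (by positivity)]
  have a := S3_big t ht ht1 _ h1
  have b := S3_big t ht ht1 _ h2
  have hs : (Real.sqrt (4 * Real.pi * t))⁻¹ ≤ (Real.sqrt t)⁻¹ := by
    have := Real.sqrt_pos.mpr ht
    gcongr
    nlinarith [Real.pi_gt_three]
  have hr : t ^ (-(7 : ℝ) / 2) = (Real.sqrt t)⁻¹ * (t ^ 3)⁻¹ := by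
    rw [Real.sqrt_eq_rpow, ← Real.rpow_natCast, ← Real.rpow_neg ht.le, ← Real.rpow_neg ht.le,
      ← Real.rpow_add ht]
    norm_num
  have hc : |-S3 t (-y) - S3 t (y - 2)| ≤ |S3 t (-y)| + |S3 t (y - 2)| := by
    have := abs_sub (-S3 t (-y)) (S3 t (y - 2))
    rwa [abs_neg] at this
  rw [hr]
  calc _ ≤ (Real.sqrt t)⁻¹ * ((t ^ 3)⁻¹ * (Real.exp (-(1 / (4 * t))) * MK (-y)) +
        (t ^ 3)⁻¹ * (Real.exp (-(1 / (4 * t))) * MK (y - 2))) := by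
        gcongr
        linarith
    _ = _ := by ring

/-- There is a constant `C > 0` such that for all `t ∈ (0,1]`:
`|∂²_x ∂_y K_t(x,y)|_{x=0,y=1}| ≤ C t^{-7/2} e^{-1/(4t)}` and
`|∂²_x ∂_y K_t(x,y)|_{x=0,y=-1}| ≤ C t^{-7/2} e^{-1/(4t)}`, where `∂_x` differentiates in the
first variable and `∂_y` in the second. -/
theorem heat_kernel_mixed_derivative_bound :
    ∃ C > (0 : ℝ), ∀ t ∈ Set.Ioc (0 : ℝ) 1,
      |deriv (fun y => deriv (deriv (fun x => K t x y)) 0) 1| ≤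
          C * t ^ (-(7 : ℝ) / 2) * Real.exp (-(1 / (4 * t))) ∧
      |deriv (fun y => deriv (deriv (fun x => K t x y)) 0) (-1)| ≤
          C * t ^ (-(7 : ℝ) / 2) * Real.exp (-(1 / (4 * t))) := by
  have n1 := MK_nonneg (-1)
  have n2 := MK_nonneg (1 - 2)
  have n3 := MK_nonneg (-(-1))
  have n4 := MK_nonneg (-1 - 2)
  refine ⟨MK (-1) + MK (1 - 2) + (MK (-(-1)) + MK (-1 - 2)) + 1, by linarith, ?_⟩
  rintro t ⟨ht, ht1⟩
  have hp : 0 < t ^ (-(7 : ℝ) / 2) := Real.rpow_pos_of_pos ht _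
  constructor
  · refine (final_bound t ht ht1 1 (fun k => one_le_abs_of_int (-1 + 4 * k) (by omega) _ (by push_cast; ring))
      (fun k => one_le_abs_of_int (-1 + 4 * k) (by omega) _ (by push_cast; ring))).trans ?_
    refine mul_le_mul_of_nonneg_right (mul_le_mul_of_nonneg_right ?_ hp.le) (Real.exp_pos _).le
    linarith
  · refine (final_bound t ht ht1 (-1) (fun k => one_le_abs_of_int (1 + 4 * k) (by omega) _ (by push_cast; ring))
      (fun k => one_le_abs_of_int (-3 + 4 * k) (by omega) _ (by push_cast; ring))).trans ?_
    refine mul_le_mul_of_nonneg_right (mul_le_mul_of_nonneg_right ?_ hp.le) (Real.exp_pos _).le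
    linarith
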